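/- Let N ≥ 2 and set S* = {(a,b) ∈ S × S : |a−b| ≤ 1}. For (a,b) ∈ S* and t ∈ [0,1], let γ_{a,b}(t) = (ta + (1−t)b)/|ta + (1−t)b| (well defined since |ta+(1−t)b| ≥ √3/2 on S* × [0,1]), and let γ̇_{a,b}(t) denote its derivative in t. Then there exists a constant C > 0, depending only on N, such that for all (a,b), (a₁,b₁), (a₂,b₂) ∈ S* and t ∈ [0,1]: (i) |γ̇_{a,b}(t)| ≤ C|a−b|; (ii) |γ_{a₁,b₁}(t) − γ_{a₂,b₂}(t)| ≤ C(|a₁−a₂| + |b₁−b₂|); (iii) |γ̇_{a₁,b₁}(t) − γ̇_{a₂,b₂}(t)| ≤ C(|a₁−a₂| + |b₁−b₂|). -/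

import Mathlib

/-- The spherical curve `t ↦ (t a + (1-t) b)/|t a + (1-t) b|` joining `b` to `a` on the sphere. -/
noncomputable def sphCurve {N : ℕ} (a b : EuclideanSpace ℝ (Fin N)) (t : ℝ) :
    EuclideanSpace ℝ (Fin N) :=
  ‖t • a + (1 - t) • b‖⁻¹ • (t • a + (1 - t) • b)

theorem inv_norm_le_two {E : Type*} [NormedAddCommGroup E] {x : E} (hx : 1 / 2 ≤ ‖x‖) :
    ‖x‖⁻¹ ≤ 2 := by
  rw [inv_le_comm₀ (by linarith) (by norm_num)]
  linarith

theorem abs_inv_norm_sub_inv_norm_le {E : Type*} [NormedAddCommGroup E] {x y : E}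
    (hx : 1 / 2 ≤ ‖x‖) (hy : 1 / 2 ≤ ‖y‖) :
    |‖x‖⁻¹ - ‖y‖⁻¹| ≤ ‖x‖⁻¹ * (2 * ‖x - y‖) := by
  have hx0 : 0 < ‖x‖ := by linarith
  have hy0 : 0 < ‖y‖ := by linarith
  have h : ‖x‖⁻¹ - ‖y‖⁻¹ = ‖x‖⁻¹ * (‖y‖⁻¹ * (‖y‖ - ‖x‖)) := by field_simp
  rw [h, abs_mul, abs_mul, abs_of_pos (inv_pos.mpr hx0), abs_of_pos (inv_pos.mpr hy0),
    abs_sub_comm]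
  gcongr
  · exact inv_norm_le_two hy
  · exact abs_norm_sub_norm_le x y

section NormedSpace

variable {E : Type*} [NormedAddCommGroup E] [NormedSpace ℝ E]

theorem norm_inv_norm_smul {x : E} (hx : x ≠ 0) : ‖‖x‖⁻¹ • x‖ = 1 := by
  rw [norm_smul, norm_inv, norm_norm, inv_mul_cancel₀ (norm_ne_zero_iff.mpr hx)]

theorem norm_inv_norm_smul_sub_le {x y : E} (hx : 1 / 2 ≤ ‖x‖) (hy : 1 / 2 ≤ ‖y‖) :
    ‖‖x‖⁻¹ • x - ‖y‖⁻¹ • y‖ ≤ 4 * ‖x - y‖ := by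
  have hx0 : ‖x‖ ≠ 0 := by linarith
  have h : ‖x‖⁻¹ • x - ‖y‖⁻¹ • y = (‖x‖⁻¹ - ‖y‖⁻¹) • x + ‖y‖⁻¹ • (x - y) := by module
  rw [h]
  refine (norm_add_le _ _).trans ?_
  rw [norm_smul, norm_smul, Real.norm_eq_abs, norm_inv, norm_norm]
  have h1 : |‖x‖⁻¹ - ‖y‖⁻¹| * ‖x‖ ≤ 2 * ‖x - y‖ := by
    calc _ ≤ ‖x‖⁻¹ * (2 * ‖x - y‖) * ‖x‖ := by
          gcongr
          exact abs_inv_norm_sub_inv_norm_le hx hy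
      _ = _ := by field_simp
  have h2 : ‖y‖⁻¹ * ‖x - y‖ ≤ 2 * ‖x - y‖ := by
    gcongr
    exact inv_norm_le_two hy
  linarith

theorem half_le_norm_segment {a b : E} (ha : ‖a‖ = 1) (hb : ‖b‖ = 1) (hab : ‖a - b‖ ≤ 1)
    {t : ℝ} (ht : t ∈ Set.Icc (0 : ℝ) 1) : 1 / 2 ≤ ‖t • a + (1 - t) • b‖ := by
  obtain ⟨h0, h1⟩ := ht
  have key : ∀ s : ℝ, 0 ≤ s → ‖s • (a - b)‖ ≤ s := fun s hs => by
    rw [norm_smul, Real.norm_of_nonneg hs]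
    exact mul_le_of_le_one_right hs hab
  have hA : t • a + (1 - t) • b = a - (1 - t) • (a - b) := by module
  have hB : t • a + (1 - t) • b = b + t • (a - b) := by module
  rcases le_total t (1 / 2) with h | h
  · rw [hB]
    linarith [norm_sub_le_norm_add b (t • (a - b)), key t h0]
  · rw [hA]
    linarith [norm_sub_norm_le a ((1 - t) • (a - b)), key (1 - t) (by linarith)]

theorem norm_segment_sub_le (a₁ b₁ a₂ b₂ : E) {t : ℝ} (ht : t ∈ Set.Icc (0 : ℝ) 1) :
    ‖(t • a₁ + (1 - t) • b₁) - (t • a₂ + (1 - t) • b₂)‖ ≤ ‖a₁ - a₂‖ + ‖b₁ - b₂‖ := by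
  obtain ⟨h0, h1⟩ := ht
  have h : (t • a₁ + (1 - t) • b₁) - (t • a₂ + (1 - t) • b₂) =
      t • (a₁ - a₂) + (1 - t) • (b₁ - b₂) := by module
  rw [h]
  refine norm_add_le_of_le ?_ ?_
  · rw [norm_smul, Real.norm_of_nonneg h0]
    exact mul_le_of_le_one_left (norm_nonneg _) h1
  · rw [norm_smul, Real.norm_of_nonneg (by linarith)]
    exact mul_le_of_le_one_left (norm_nonneg _) (by linarith)

end NormedSpace

section InnerProductSpace

variable {E : Type*} [NormedAddCommGroup E] [InnerProductSpace ℝ E]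

theorem hasDerivAt_inv_norm_smul {f : ℝ → E} {f' : E} {t : ℝ} (hf : HasDerivAt f f' t)
    (h0 : f t ≠ 0) :
    HasDerivAt (fun s => ‖f s‖⁻¹ • f s)
      (‖f t‖⁻¹ • (f' - inner ℝ (‖f t‖⁻¹ • f t) f' • ‖f t‖⁻¹ • f t)) t := by
  have hr : ‖f t‖ ≠ 0 := norm_ne_zero_iff.mpr h0
  have hnorm : HasDerivAt (fun s => ‖f s‖) (inner ℝ (f t) f' / ‖f t‖) t := by
    have h := hf.norm_sq.sqrt (pow_ne_zero 2 hr)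
    simp only [Real.sqrt_sq (norm_nonneg _)] at h
    convert h using 1
    field_simp
  refine ((hnorm.inv hr).smul hf).congr_deriv ?_
  simp only [Pi.inv_apply, real_inner_smul_left]
  match_scalars <;> field_simp

theorem norm_sub_inner_smul_le {u d : E} (hu : ‖u‖ = 1) :
    ‖d - inner ℝ u d • u‖ ≤ 2 * ‖d‖ := by
  have h : ‖inner ℝ u d • u‖ ≤ ‖d‖ := by
    rw [norm_smul, hu, mul_one]
    simpa [hu] using norm_inner_le_norm (𝕜 := ℝ) u d
  linarith [norm_sub_le d (inner ℝ u d • u)]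

theorem norm_sub_inner_smul_sub_le {u v d e : E} (hu : ‖u‖ = 1) (hv : ‖v‖ = 1)
    (he : ‖e‖ ≤ 1) :
    ‖(d - inner ℝ u d • u) - (e - inner ℝ v e • v)‖ ≤ 2 * ‖d - e‖ + 2 * ‖u - v‖ := by
  have h : (d - inner ℝ u d • u) - (e - inner ℝ v e • v) =
      ((d - e) - inner ℝ u (d - e) • u) - (inner ℝ (u - v) e • u + inner ℝ v e • (u - v)) := by
    simp only [inner_sub_left, inner_sub_right]
    module
  have h1 : ‖inner ℝ (u - v) e • u‖ ≤ ‖u - v‖ := by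
    rw [norm_smul, hu, mul_one]
    exact (norm_inner_le_norm _ _).trans (mul_le_of_le_one_right (norm_nonneg _) he)
  have h2 : ‖inner ℝ v e • (u - v)‖ ≤ ‖u - v‖ := by
    rw [norm_smul]
    refine mul_le_of_le_one_left (norm_nonneg _) ((norm_inner_le_norm _ _).trans ?_)
    rwa [hv, one_mul]
  rw [h]
  linarith [norm_sub_le ((d - e) - inner ℝ u (d - e) • u)
    (inner ℝ (u - v) e • u + inner ℝ v e • (u - v)),
    norm_add_le (inner ℝ (u - v) e • u) (inner ℝ v e • (u - v)),
    norm_sub_inner_smul_le (d := d - e) hu]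

end InnerProductSpace

theorem deriv_sphCurve {N : ℕ} {a b : EuclideanSpace ℝ (Fin N)} {t : ℝ}
    (h0 : t • a + (1 - t) • b ≠ 0) :
    deriv (sphCurve a b) t = ‖t • a + (1 - t) • b‖⁻¹ •
      ((a - b) - inner ℝ (sphCurve a b t) (a - b) • sphCurve a b t) := by
  have h : HasDerivAt (fun s : ℝ => s • a + (1 - s) • b) (a - b) t := by
    refine (((hasDerivAt_id t).smul_const a).add
      (((hasDerivAt_id t).const_sub 1).smul_const b)).congr_deriv ?_
    module
  exact (hasDerivAt_inv_norm_smul h h0).deriv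

theorem stmt13 (N : ℕ) (hN : 2 ≤ N) :
    ∃ C : ℝ, 0 < C ∧
      ∀ a b a₁ b₁ a₂ b₂ : EuclideanSpace ℝ (Fin N),
        a ∈ Metric.sphere (0 : EuclideanSpace ℝ (Fin N)) 1 →
        b ∈ Metric.sphere (0 : EuclideanSpace ℝ (Fin N)) 1 → ‖a - b‖ ≤ 1 →
        a₁ ∈ Metric.sphere (0 : EuclideanSpace ℝ (Fin N)) 1 →
        b₁ ∈ Metric.sphere (0 : EuclideanSpace ℝ (Fin N)) 1 → ‖a₁ - b₁‖ ≤ 1 →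
        a₂ ∈ Metric.sphere (0 : EuclideanSpace ℝ (Fin N)) 1 →
        b₂ ∈ Metric.sphere (0 : EuclideanSpace ℝ (Fin N)) 1 → ‖a₂ - b₂‖ ≤ 1 →
        ∀ t ∈ Set.Icc (0 : ℝ) 1,
          ‖deriv (sphCurve a b) t‖ ≤ C * ‖a - b‖ ∧
          ‖sphCurve a₁ b₁ t - sphCurve a₂ b₂ t‖ ≤ C * (‖a₁ - a₂‖ + ‖b₁ - b₂‖) ∧
          ‖deriv (sphCurve a₁ b₁) t - deriv (sphCurve a₂ b₂) t‖ ≤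
            C * (‖a₁ - a₂‖ + ‖b₁ - b₂‖) := by
  refine ⟨28, by norm_num, fun a b a₁ b₁ a₂ b₂ ha hb hab ha₁ hb₁ hab₁ ha₂ hb₂ hab₂ t ht => ?_⟩
  rw [mem_sphere_zero_iff_norm] at ha hb ha₁ hb₁ ha₂ hb₂
  have hp := half_le_norm_segment ha hb hab ht
  have hp₁ := half_le_norm_segment ha₁ hb₁ hab₁ ht
  have hp₂ := half_le_norm_segment ha₂ hb₂ hab₂ ht
  have ne_zero_of_half_le : ∀ x : EuclideanSpace ℝ (Fin N), 1 / 2 ≤ ‖x‖ → x ≠ 0 :=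
    fun x hx => norm_pos_iff.mp (by linarith)
  have hu : ‖sphCurve a b t‖ = 1 := norm_inv_norm_smul (ne_zero_of_half_le _ hp)
  have hu₁ : ‖sphCurve a₁ b₁ t‖ = 1 := norm_inv_norm_smul (ne_zero_of_half_le _ hp₁)
  have hu₂ : ‖sphCurve a₂ b₂ t‖ = 1 := norm_inv_norm_smul (ne_zero_of_half_le _ hp₂)
  have hδ := norm_segment_sub_le a₁ b₁ a₂ b₂ ht
  have hδ0 : 0 ≤ ‖a₁ - a₂‖ + ‖b₁ - b₂‖ := by positivity
  have hcurve : ‖sphCurve a₁ b₁ t - sphCurve a₂ b₂ t‖ ≤ 4 * (‖a₁ - a₂‖ + ‖b₁ - b₂‖) :=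
    (norm_inv_norm_smul_sub_le hp₁ hp₂).trans (by gcongr)
  refine ⟨?_, by linarith, ?_⟩
  · rw [deriv_sphCurve (ne_zero_of_half_le _ hp), norm_smul, norm_inv, norm_norm]
    calc _ ≤ 2 * (2 * ‖a - b‖) := by
          gcongr
          · exact inv_norm_le_two hp
          · exact norm_sub_inner_smul_le hu
      _ ≤ _ := by linarith [norm_nonneg (a - b)]
  · rw [deriv_sphCurve (ne_zero_of_half_le _ hp₁), deriv_sphCurve (ne_zero_of_half_le _ hp₂)]
    have hr := abs_inv_norm_sub_inv_norm_le hp₁ hp₂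
    have hi₁ := inv_norm_le_two hp₁
    have hi₂ := inv_norm_le_two hp₂
    have hw₁ := norm_sub_inner_smul_le (d := a₁ - b₁) hu₁
    have hw := norm_sub_inner_smul_sub_le (d := a₁ - b₁) hu₁ hu₂ hab₂
    have hd : ‖(a₁ - b₁) - (a₂ - b₂)‖ ≤ ‖a₁ - a₂‖ + ‖b₁ - b₂‖ := by
      rw [sub_sub_sub_comm]
      exact norm_sub_le _ _
    set p₁ := t • a₁ + (1 - t) • b₁
    set p₂ := t • a₂ + (1 - t) • b₂
    set w₁ := (a₁ - b₁) - inner ℝ (sphCurve a₁ b₁ t) (a₁ - b₁) • sphCurve a₁ b₁ t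
    set w₂ := (a₂ - b₂) - inner ℝ (sphCurve a₂ b₂ t) (a₂ - b₂) • sphCurve a₂ b₂ t
    set δ := ‖a₁ - a₂‖ + ‖b₁ - b₂‖
    have hsplit : ‖p₁‖⁻¹ • w₁ - ‖p₂‖⁻¹ • w₂ =
        (‖p₁‖⁻¹ - ‖p₂‖⁻¹) • w₁ + ‖p₂‖⁻¹ • (w₁ - w₂) := by module
    rw [hsplit]
    refine (norm_add_le _ _).trans ?_
    rw [norm_smul, norm_smul, Real.norm_eq_abs, norm_inv, norm_norm]
    calc _ ≤ (2 * (2 * δ)) * 2 + 2 * (10 * δ) := by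
          gcongr
          · exact hr.trans (by gcongr)
          · linarith
          · linarith
      _ = 28 * δ := by ring
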